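/- arXiv:2505.19340 — 2 statements merged into one kernel-verified Lean document; each statement's English description precedes it below -/
import Mathlib

section
/- If G is a connected graph, e ∈ E(G), and G−e is connected, then μ_o(G−e) ≤ 2·μ_o(G) + 1, where μ_o is the outer mutual-visibility number. -/
open SimpleGraph

/-- `u` and `v` are `X`-visible in `G`: there is a shortest `u,v`-walk whose
vertices meet `X` only possibly in `u` and `v`. -/
def IsMVisible {V : Type*} (G : SimpleGraph V) (X : Set V) (u v : V) : Prop :=
  ∃ P : G.Walk u v, P.length = G.dist u v ∧
    ∀ w ∈ P.support, w ∈ X → w = u ∨ w = v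

/-- mutual-visibility set -/
def IsMVSet {V : Type*} (G : SimpleGraph V) (X : Set V) : Prop :=
  ∀ u ∈ X, ∀ v ∈ X, IsMVisible G X u v

/-- outer mutual-visibility set -/
def IsOuterMVSet {V : Type*} (G : SimpleGraph V) (X : Set V) : Prop :=
  ∀ u ∈ X, ∀ v : V, IsMVisible G X u v

/-- dual mutual-visibility set -/
def IsDualMVSet {V : Type*} (G : SimpleGraph V) (X : Set V) : Prop :=
  (∀ u ∈ X, ∀ v ∈ X, IsMVisible G X u v) ∧
  (∀ u ∉ X, ∀ v ∉ X, IsMVisible G X u v)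

/-- total mutual-visibility set -/
def IsTotalMVSet {V : Type*} (G : SimpleGraph V) (X : Set V) : Prop :=
  ∀ u v : V, IsMVisible G X u v

/-- the mutual-visibility number μ(G) -/
noncomputable def mu {V : Type*} (G : SimpleGraph V) : ℕ :=
  sSup {n | ∃ X : Set V, IsMVSet G X ∧ X.ncard = n}

/-- the outer mutual-visibility number μₒ(G) -/
noncomputable def muO {V : Type*} (G : SimpleGraph V) : ℕ :=
  sSup {n | ∃ X : Set V, IsOuterMVSet G X ∧ X.ncard = n}

/-- the dual mutual-visibility number μ_d(G) -/
noncomputable def muD {V : Type*} (G : SimpleGraph V) : ℕ :=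
  sSup {n | ∃ X : Set V, IsDualMVSet G X ∧ X.ncard = n}

/-- the total mutual-visibility number μ_t(G) -/
noncomputable def muT {V : Type*} (G : SimpleGraph V) : ℕ :=
  sSup {n | ∃ X : Set V, IsTotalMVSet G X ∧ X.ncard = n}

section AddEdge

variable {V : Type*} {G H : SimpleGraph V} {x y : V}

/-- A walk in `G`, which has at most the edge `xy` more than `H`, is no shorter than an `H`-geodesic
or than a concatenation of two `H`-geodesics through that edge. -/
lemma dist_le_walk_length_of_add_edge (hH : H.Connected)
    (hGH : ∀ a b, G.Adj a b → H.Adj a b ∨ (a = x ∧ b = y) ∨ (a = y ∧ b = x))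
    {u v : V} (p : G.Walk u v) :
    H.dist u v ≤ p.length ∨ H.dist u x + 1 + H.dist y v ≤ p.length ∨
      H.dist u y + 1 + H.dist x v ≤ p.length := by
  induction p with
  | nil => simp
  | @cons a b c h p ih =>
    rw [Walk.length_cons]
    rcases hGH a b h with h | ⟨rfl, rfl⟩ | ⟨rfl, rfl⟩
    · have hd := dist_eq_one_iff_adj.mpr h
      have hc := hH.dist_triangle (u := a) (v := b) (w := c)
      have hx := hH.dist_triangle (u := a) (v := b) (w := x)
      have hy := hH.dist_triangle (u := a) (v := b) (w := y)
      omega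
    · simp only [SimpleGraph.dist_self] at ih ⊢
      omega
    · simp only [SimpleGraph.dist_self] at ih ⊢
      omega

lemma dist_cases_of_add_edge (hG : G.Connected) (hH : H.Connected)
    (hGH : ∀ a b, G.Adj a b → H.Adj a b ∨ (a = x ∧ b = y) ∨ (a = y ∧ b = x)) (u v : V) :
    H.dist u v ≤ G.dist u v ∨ H.dist u x + 1 + H.dist y v ≤ G.dist u v ∨
      H.dist u y + 1 + H.dist x v ≤ G.dist u v := by
  obtain ⟨p, hp⟩ := hG.exists_walk_length_eq_dist u v
  exact hp ▸ dist_le_walk_length_of_add_edge hH hGH p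

lemma IsMVisible.of_le_of_dist_le {X S : Set V} {u v : V} (hle : H ≤ G) (hSX : S ⊆ X)
    (h : IsMVisible H X u v) (hd : H.dist u v ≤ G.dist u v) : IsMVisible G S u v := by
  obtain ⟨P, hP, hPX⟩ := h
  refine ⟨P.mapLe hle, le_antisymm ?_ (dist_le _), fun w hw hwS => hPX w ?_ (hSX hwS)⟩
  · simpa [hP] using hd
  · simpa using hw

lemma isMVisible_of_through_edge {S : Set V} {u v : V} (hle : H ≤ G) (hxy : G.Adj x y)
    (hd : H.dist u x + 1 + H.dist y v ≤ G.dist u v)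
    (P : H.Walk u x) (hP : P.length = H.dist u x) (hPS : ∀ w ∈ P.support, w ∈ S → w = u)
    (Q : H.Walk y v) (hQ : Q.length = H.dist y v) (hQS : ∀ w ∈ Q.support, w ∈ S → w = v) :
    IsMVisible G S u v := by
  refine ⟨(P.mapLe hle).append (.cons hxy (Q.mapLe hle)), le_antisymm ?_ (dist_le _), ?_⟩
  · simp only [Walk.length_append, Walk.length_cons, Walk.length_map]
    omega
  · intro w hw hwS
    simp only [Walk.mem_support_append_iff, Walk.support_cons, List.mem_cons,
      Walk.support_mapLe_eq_support] at hw
    rcases hw with hw | rfl | hw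
    · exact .inl (hPS w hw hwS)
    · exact .inl (hPS w P.end_mem_support hwS)
    · exact .inr (hQS w hw hwS)

lemma IsOuterMVSet.of_add_edge_near {X : Set V} (hX : IsOuterMVSet H X) (hG : G.Connected)
    (hH : H.Connected) (hle : H ≤ G) (hxy : G.Adj x y)
    (hGH : ∀ a b, G.Adj a b → H.Adj a b ∨ (a = x ∧ b = y) ∨ (a = y ∧ b = x)) :
    IsOuterMVSet G {u ∈ X | H.dist u x ≤ H.dist u y ∧ u ≠ x} := by
  intro u hu v
  by_cases hlt : H.dist u v ≤ G.dist u v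
  · exact (hX u hu.1 v).of_le_of_dist_le hle (Set.sep_subset _ _) hlt
  have hux := hu.2.1
  have htri := hH.dist_triangle (u := u) (v := x) (w := v)
  have hd : H.dist u x + 1 + H.dist y v ≤ G.dist u v := by
    have := dist_cases_of_add_edge hG hH hGH u v
    omega
  obtain ⟨P, hP, hPX⟩ := hX u hu.1 x
  obtain ⟨Q, hQ⟩ := hH.exists_walk_length_eq_dist y v
  refine isMVisible_of_through_edge hle hxy hd P hP
    (fun w hw hwS => (hPX w hw hwS.1).resolve_right hwS.2.2) Q hQ fun w hw hwS => ?_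
  exfalso
  classical
  have hlen := congrArg Walk.length (Q.take_spec hw)
  rw [Walk.length_append] at hlen
  have hyw := dist_le (Q.takeUntil w hw)
  have hwv := dist_le (Q.dropUntil w hw)
  have hwx := hwS.2.1
  have htri' := hH.dist_triangle (u := x) (v := w) (w := v)
  rw [H.dist_comm (u := x) (v := w)] at htri'
  rw [H.dist_comm (u := y) (v := w)] at hyw
  omega

lemma IsOuterMVSet.of_add_edge_diff_pair {X : Set V} (hX : IsOuterMVSet H X) (hG : G.Connected)
    (hH : H.Connected) (hle : H ≤ G) (hxy : G.Adj x y)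
    (hGH : ∀ a b, G.Adj a b → H.Adj a b ∨ (a = x ∧ b = y) ∨ (a = y ∧ b = x))
    (hx : x ∈ X) (hy : y ∈ X) : IsOuterMVSet G (X \ {x, y}) := by
  intro u hu v
  have through {a b : V} (hab : G.Adj a b) (ha : a ∉ X \ {x, y}) (hb : b ∈ X)
      (hb' : b ∉ X \ {x, y}) (hd : H.dist u a + 1 + H.dist b v ≤ G.dist u v) :
      IsMVisible G (X \ {x, y}) u v := by
    obtain ⟨P, hP, hPX⟩ := hX u hu.1 a
    obtain ⟨Q, hQ, hQX⟩ := hX b hb v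
    exact isMVisible_of_through_edge hle hab hd P hP
      (fun w hw hwS => (hPX w hw hwS.1).resolve_right fun h => ha (h ▸ hwS)) Q hQ
      (fun w hw hwS => (hQX w hw hwS.1).resolve_left fun h => hb' (h ▸ hwS))
  rcases dist_cases_of_add_edge hG hH hGH u v with h | h | h
  · exact (hX u hu.1 v).of_le_of_dist_le hle Set.sdiff_subset h
  · exact through hxy (by simp) hy (by simp) h
  · exact through hxy.symm (by simp) hx (by simp) h

end AddEdge

lemma IsOuterMVSet.ncard_le_muO {V : Type*} [Finite V] {G : SimpleGraph V} {X : Set V}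
    (hX : IsOuterMVSet G X) : X.ncard ≤ muO G :=
  le_csSup ⟨Nat.card V, fun _ ⟨Y, _, hY⟩ => hY ▸ Set.ncard_le_card Y⟩ ⟨X, hX, rfl⟩

lemma SimpleGraph.Connected.isOuterMVSet_singleton {V : Type*} {G : SimpleGraph V}
    (hG : G.Connected) (u : V) : IsOuterMVSet G {u} := by
  rintro _ rfl v
  obtain ⟨P, hP⟩ := hG.exists_walk_length_eq_dist _ v
  exact ⟨P, hP, fun w _ hw => .inl hw⟩

theorem stmt_6 {V : Type*} [Fintype V] (G : SimpleGraph V) (hG : G.Connected)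
    (x y : V) (hxy : G.Adj x y)
    (hconn : (G.deleteEdges {s(x, y)}).Connected) :
    muO (G.deleteEdges {s(x, y)}) ≤ 2 * muO G + 1 := by
  have hle : G.deleteEdges {s(x, y)} ≤ G := G.deleteEdges_le _
  have hGH : ∀ a b, G.Adj a b →
      (G.deleteEdges {s(x, y)}).Adj a b ∨ (a = x ∧ b = y) ∨ (a = y ∧ b = x) := by
    intro a b hab
    simp only [deleteEdges_adj, hab, Set.mem_singleton_iff, Sym2.eq_iff, true_and]
    tauto
  generalize G.deleteEdges {s(x, y)} = H at *
  have hpos := (hG.isOuterMVSet_singleton x).ncard_le_muO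
  rw [Set.ncard_singleton] at hpos
  refine csSup_le ⟨_, {x}, hconn.isOuterMVSet_singleton x, rfl⟩ ?_
  rintro _ ⟨X, hX, rfl⟩
  by_cases h : x ∈ X ∧ y ∈ X
  · have hS := (hX.of_add_edge_diff_pair hG hconn hle hxy hGH h.1 h.2).ncard_le_muO
    have hcard := Set.ncard_le_ncard_sdiff_add_ncard X {x, y}
    rw [Set.ncard_pair hxy.ne] at hcard
    omega
  · have hA := (hX.of_add_edge_near hG hconn hle hxy hGH).ncard_le_muO
    have hB := (hX.of_add_edge_near hG hconn hle hxy.symm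
      fun a b hab => (hGH a b hab).imp_right Or.symm).ncard_le_muO
    have hC : (X ∩ {x, y}).ncard ≤ 1 := by
      rw [Set.ncard_le_one_iff]
      rintro a b ⟨ha, rfl | rfl⟩ ⟨hb, rfl | rfl⟩ <;> tauto
    have hcover : X ⊆ ({u ∈ X | H.dist u x ≤ H.dist u y ∧ u ≠ x} ∪
        {u ∈ X | H.dist u y ≤ H.dist u x ∧ u ≠ y}) ∪ (X ∩ {x, y}) := by
      intro u hu
      have := le_total (H.dist u x) (H.dist u y)
      simp only [Set.mem_union, Set.mem_ofPred_eq, Set.mem_inter_iff, Set.mem_insert_iff,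
        Set.mem_singleton_iff]
      tauto
    have hcard := Set.ncard_le_ncard hcover
    have h₁ := Set.ncard_union_le ({u ∈ X | H.dist u x ≤ H.dist u y ∧ u ≠ x} ∪
        {u ∈ X | H.dist u y ≤ H.dist u x ∧ u ≠ y}) (X ∩ {x, y})
    have h₂ := Set.ncard_union_le {u ∈ X | H.dist u x ≤ H.dist u y ∧ u ≠ x}
        {u ∈ X | H.dist u y ≤ H.dist u x ∧ u ≠ y}
    omega
end

section
/- There is no connected graph G of order 7 with dual mutual-visibility number μ_d(G) = 1. -/
open SimpleGraph

/-- Every two vertices outside `{x, y}` that are distinct, non-adjacent and have the common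
neighbour `z` have a common neighbour outside `{x, y}`. -/
def Bypass {V : Type*} (G : SimpleGraph V) (x y z : V) : Prop :=
  ∀ a b, a ≠ x → a ≠ y → b ≠ x → b ≠ y → G.Adj z a → G.Adj z b →
    a = b ∨ G.Adj a b ∨ ∃ c, c ≠ x ∧ c ≠ y ∧ G.Adj a c ∧ G.Adj c b

/-- Every path `a, x, y, b` can be replaced by a walk from `a` to `b` of length at most three
that avoids `x` and `y`. -/
def EdgeBypass {V : Type*} (G : SimpleGraph V) (x y : V) : Prop :=
  G.Adj x y → ∀ a b, a ≠ x → a ≠ y → b ≠ x → b ≠ y → G.Adj x a → G.Adj y b →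
    a = b ∨ G.Adj a b ∨ (∃ c, c ≠ x ∧ c ≠ y ∧ G.Adj a c ∧ G.Adj c b) ∨
      ∃ c, c ≠ x ∧ c ≠ y ∧ G.Adj a c ∧ ∃ d, d ≠ x ∧ d ≠ y ∧ G.Adj c d ∧ G.Adj d b

lemma EdgeBypass.symm {V : Type*} {G : SimpleGraph V} {x y : V} (h : EdgeBypass G x y) :
    EdgeBypass G y x := by
  intro hyx a b hay hax hby hbx hya hxb
  rcases h hyx.symm b a hbx hby hax hay hxb hya with
    h | h | ⟨c, hcx, hcy, h, h'⟩ | ⟨c, hcx, hcy, h, d, hdx, hdy, h', h''⟩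
  · exact .inl h.symm
  · exact .inr (.inl h.symm)
  · exact .inr (.inr (.inl ⟨c, hcy, hcx, h'.symm, h.symm⟩))
  · exact .inr (.inr (.inr ⟨d, hdy, hdx, h''.symm, c, hcy, hcx, h'.symm, h.symm⟩))

lemma Bypass.swap {V : Type*} {G : SimpleGraph V} {x y z : V} (h : Bypass G x y z) :
    Bypass G y x z := by
  intro a b hay hax hby hbx hza hzb
  rcases h a b hax hay hbx hby hza hzb with h | h | ⟨c, hcx, hcy, h⟩
  · exact .inl h
  · exact .inr (.inl h)
  · exact .inr (.inr ⟨c, hcy, hcx, h⟩)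

/-- There is a walk from `u` to `v` of length at most `n` that avoids `x` and `y`. -/
def AvoidingWalk {V : Type*} (G : SimpleGraph V) (x y : V) (n : ℕ) (u v : V) : Prop :=
  ∃ q : G.Walk u v, q.length ≤ n ∧ x ∉ q.support ∧ y ∉ q.support

lemma AvoidingWalk.mono {V : Type*} {G : SimpleGraph V} {x y u v : V} {m n : ℕ}
    (h : AvoidingWalk G x y m u v) (hmn : m ≤ n) : AvoidingWalk G x y n u v :=
  let ⟨q, hq, h⟩ := h
  ⟨q, hq.trans hmn, h⟩

lemma AvoidingWalk.swap {V : Type*} {G : SimpleGraph V} {x y u v : V} {n : ℕ}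
    (h : AvoidingWalk G x y n u v) : AvoidingWalk G y x n u v :=
  let ⟨q, hq, hx, hy⟩ := h
  ⟨q, hq, hy, hx⟩

lemma AvoidingWalk.cons {V : Type*} {G : SimpleGraph V} {x y u w v : V} {n : ℕ}
    (huw : G.Adj u w) (hux : u ≠ x) (huy : u ≠ y) (h : AvoidingWalk G x y n w v) :
    AvoidingWalk G x y (n + 1) u v := by
  obtain ⟨q, hq, hx, hy⟩ := h
  exact ⟨.cons huw q, by simpa using hq, by simp [hux.symm, hx], by simp [huy.symm, hy]⟩

/-- The induction step for `avoidingWalk_of_bypass` at a walk that enters `{x, y}` at `x`. -/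
lemma avoidingWalk_of_bypass_step {V : Type*} {G : SimpleGraph V} {x y : V}
    (hx : Bypass G x y x) (hxy : EdgeBypass G x y) {n : ℕ}
    (ih : ∀ m < n, ∀ u v, u ≠ x → u ≠ y → v ≠ x → v ≠ y →
      ∀ p : G.Walk u v, p.length = m → AvoidingWalk G x y m u v)
    {u v : V} (hux : u ≠ x) (huy : u ≠ y) (hvx : v ≠ x) (hvy : v ≠ y)
    (hu : G.Adj u x) (p : G.Walk x v) (hp : p.length + 1 = n) : AvoidingWalk G x y n u v := by
  cases p with
  | nil => exact absurd rfl hvx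
  | @cons _ z _ hz p =>
    simp only [Walk.length_cons] at hp
    by_cases hzy : z = y
    · subst hzy
      cases p with
      | nil => exact absurd rfl hvy
      | @cons _ t _ ht p =>
        simp only [Walk.length_cons] at hp
        by_cases htx : t = x
        · subst htx
          exact (ih (p.length + 1) (by omega) u v hux huy hvx hvy (.cons hu p) (by simp)).mono
            (by omega)
        · have htz : t ≠ z := ht.ne'
          have hq := ih p.length (by omega) t v htx htz hvx hvy p rfl
          rcases hxy hz u t hux huy htx htz hu.symm ht with
            h | h | ⟨c, hcx, hcy, h, h'⟩ | ⟨c, hcx, hcy, h, d, hdx, hdy, h', h''⟩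
          · subst h; exact hq.mono (by omega)
          · exact (hq.cons h hux huy).mono (by omega)
          · exact ((hq.cons h' hcx hcy).cons h hux huy).mono (by omega)
          · exact (((hq.cons h'' hdx hdy).cons h' hcx hcy).cons h hux huy).mono (by omega)
    · have hzx : z ≠ x := hz.ne'
      have hq := ih p.length (by omega) z v hzx hzy hvx hvy p rfl
      rcases hx u z hux huy hzx hzy hu.symm hz with h | h | ⟨c, hcx, hcy, h, h'⟩
      · subst h; exact hq.mono (by omega)
      · exact (hq.cons h hux huy).mono (by omega)
      · exact ((hq.cons h' hcx hcy).cons h hux huy).mono (by omega)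

lemma avoidingWalk_of_bypass {V : Type*} {G : SimpleGraph V} {x y : V}
    (hx : Bypass G x y x) (hy : Bypass G x y y) (hxy : EdgeBypass G x y) (n : ℕ) :
    ∀ u v, u ≠ x → u ≠ y → v ≠ x → v ≠ y →
      ∀ p : G.Walk u v, p.length = n → AvoidingWalk G x y n u v := by
  induction n using Nat.strong_induction_on with
  | _ n ih =>
    intro u v hux huy hvx hvy p hp
    cases p with
    | nil => exact ⟨.nil, by simp, by simpa using hux.symm, by simpa using huy.symm⟩
    | @cons _ w _ hw p =>
      simp only [Walk.length_cons] at hp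
      by_cases hwx : w = x
      · subst hwx
        exact avoidingWalk_of_bypass_step hx hxy ih hux huy hvx hvy hw p hp
      by_cases hwy : w = y
      · subst hwy
        exact (avoidingWalk_of_bypass_step hy.swap hxy.symm
          (fun m hm u v h₁ h₂ h₃ h₄ p hp ↦ (ih m hm u v h₂ h₁ h₄ h₃ p hp).swap)
          huy hux hvy hvx hw p hp).swap
      · exact ((ih p.length (by omega) w v hwx hwy hvx hvy p rfl).cons hw hux huy).mono hp.le

lemma isDualMVSet_pair {V : Type*} {G : SimpleGraph V} (hG : G.Connected) {x y : V}
    (hx : Bypass G x y x) (hy : Bypass G x y y) (hxy : EdgeBypass G x y) :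
    IsDualMVSet G {x, y} := by
  constructor
  · intro u hu v hv
    by_cases huv : u = v
    · subst huv
      exact ⟨.nil, by simp, by simp⟩
    · obtain ⟨p, hp⟩ := hG.exists_walk_length_eq_dist u v
      refine ⟨p, hp, fun w _ hw ↦ ?_⟩
      simp only [Set.mem_insert_iff, Set.mem_singleton_iff] at hu hv hw
      grind
  · intro u hu v hv
    simp only [Set.mem_insert_iff, Set.mem_singleton_iff, not_or] at hu hv
    obtain ⟨p, hp⟩ := hG.exists_walk_length_eq_dist u v
    obtain ⟨q, hq, hqx, hqy⟩ :=
      avoidingWalk_of_bypass hx hy hxy p.length u v hu.1 hu.2 hv.1 hv.2 p rfl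
    refine ⟨q, le_antisymm (hq.trans hp.le) (dist_le q), fun w hw hwX ↦ ?_⟩
    simp only [Set.mem_insert_iff, Set.mem_singleton_iff] at hwX
    rcases hwX with rfl | rfl
    · exact absurd hw hqx
    · exact absurd hw hqy

lemma bypass_of_isDualMVSet_singleton {V : Type*} {G : SimpleGraph V} {x : V}
    (h : IsDualMVSet G {x}) : Bypass G x x x := by
  intro a b hax _ hbx _ ha hb
  obtain ⟨p, hp, hpx⟩ := h.2 a (by simpa using hax) b (by simpa using hbx)
  have hle : p.length ≤ 2 := hp.le.trans (dist_le (.cons ha.symm (.cons hb .nil)))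
  cases p with
  | nil => exact .inl rfl
  | @cons _ c _ hac p =>
    cases p with
    | nil => exact .inr (.inl hac)
    | @cons _ d _ hcd p =>
      cases p with
      | nil =>
        have hcx : c ≠ x := by
          rintro rfl
          rcases hpx c (by simp) rfl with h | h
          · exact hax h.symm
          · exact hbx h.symm
        exact .inr (.inr ⟨c, hcx, hcx, hac, hcd⟩)
      | cons _ p => simp at hle

/-- If `x` can be bypassed, and so can `y` without using `x`, then the pair `x`, `y` can be
bypassed as a whole. -/
lemma bypass_pair_of_bypass {V : Type*} {G : SimpleGraph V} {x y : V} (hxy : x ≠ y)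
    (hx : Bypass G x x x) (hy : Bypass G x y y) : Bypass G x y x ∧ EdgeBypass G x y := by
  constructor
  · intro a b hax hay hbx hby ha hb
    rcases hx a b hax hax hbx hbx ha hb with h | h | ⟨c, hcx, -, h, h'⟩
    · exact .inl h
    · exact .inr (.inl h)
    · by_cases hcy : c = y
      · subst hcy
        exact hy a b hax hay hbx hby h.symm h'
      · exact .inr (.inr ⟨c, hcx, hcy, h, h'⟩)
  · intro hadj a b hax hay hbx hby ha hb
    rcases hx a y hax hax hxy.symm hxy.symm ha hadj with h | h | ⟨c, hcx, -, h, h'⟩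
    · exact absurd h hay
    · rcases hy a b hax hay hbx hby h.symm hb with h | h | h
      · exact .inl h
      · exact .inr (.inl h)
      · exact .inr (.inr (.inl h))
    · have hcy : c ≠ y := h'.ne
      rcases hy c b hcx hcy hbx hby h'.symm hb with h₁ | h₁ | ⟨d, hdx, hdy, h₁, h₂⟩
      · subst h₁; exact .inr (.inl h)
      · exact .inr (.inr (.inl ⟨c, hcx, hcy, h, h₁⟩))
      · exact .inr (.inr (.inr ⟨c, hcx, hcy, h, d, hdx, hdy, h₁, h₂⟩))

/-- The entry in position `(a, b)` of a matrix of bits with rows of length eight. -/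
def bitAt (m a b : ℕ) : Bool := m.testBit (8 * a + b)

/-- Set the entries in positions `(a, b)` and `(b, a)`. -/
def setBits (m a b : ℕ) : ℕ := m ||| 2 ^ (8 * a + b) ||| 2 ^ (8 * b + a)

/-- The labels different from `x` and `y`. -/
def others (x y : ℕ) : List ℕ := (List.range 7).filter fun a ↦ !(a == x) && !(a == y)

/-- The known edges `p` contain a walk of length two from `a` to `b` with inner vertex in `l`. -/
def sureCommon (p : ℕ) (l : List ℕ) (a b : ℕ) : Bool :=
  l.any fun c ↦ bitAt p a c && bitAt p c b

/-- The known edges `p` and non-edges `n` guarantee `Bypass` at `z`, where `l` lists the vertices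
that may be used. -/
def sureBypass (p n : ℕ) (l : List ℕ) (z : ℕ) : Bool :=
  l.all fun a ↦ bitAt n z a || l.all fun b ↦
    bitAt n z b || (a == b || (bitAt p a b || sureCommon p l a b))

/-- The known edges `p` and non-edges `n` guarantee `EdgeBypass` at `x`, `y`, where `l` lists the
vertices that may be used. -/
def sureEdgeBypass (p n : ℕ) (l : List ℕ) (x y : ℕ) : Bool :=
  bitAt n x y || l.all fun a ↦ bitAt n x a || l.all fun b ↦
    bitAt n y b || (a == b || (bitAt p a b || (sureCommon p l a b ||
      l.any fun c ↦ bitAt p a c && sureCommon p l c b)))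

/-- The known edges `p` and non-edges `n` contradict `Bypass` at `0`. -/
def sureNotBypass (p n : ℕ) : Bool :=
  (others 0 0).any fun a ↦ bitAt p 0 a && (others 0 0).any fun b ↦ bitAt p 0 b && (!(a == b) &&
    (bitAt n a b && (others 0 0).all fun c ↦ bitAt n a c || bitAt n c b))

/-- A case distinction on the adjacency of pairs of vertices labelled `0, …, 6`. -/
inductive CaseTree
  /-- Distinguish whether `a` and `b` are non-adjacent or adjacent. -/
  | split (a b : ℕ) (l r : CaseTree)
  /-- The pair `x`, `y` can be bypassed. -/
  | pair (x y : ℕ)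
  /-- The vertex `0` cannot be bypassed. -/
  | first
  /-- The vertices `2` and `3` have a common neighbour besides `0` and `1`. -/
  | common

/-- Every leaf of the tree is justified by the known edges `p` and non-edges `n`. -/
def CaseTree.check : CaseTree → ℕ → ℕ → Bool
  | split a b l r, p, n =>
    (a < 7 && b < 7) && (l.check p (setBits n a b) && r.check (setBits p a b) n)
  | pair x y, p, n =>
    (x < y && y < 7) && (sureBypass p n (others x y) x && (sureBypass p n (others x y) y &&
      sureEdgeBypass p n (others x y) x y))
  | first, p, n => sureNotBypass p n
  | common, p, _ => sureCommon p [4, 5, 6] 2 3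

/-- The relation `R` holds at all positions of the entries of `m`. -/
def Knows (m : ℕ) (R : ℕ → ℕ → Prop) : Prop :=
  ∀ a < 7, ∀ b < 7, bitAt m a b = true → R a b

lemma Knows.setBits {m : ℕ} {R : ℕ → ℕ → Prop} (h : Knows m R) {a b : ℕ} (ha : a < 7)
    (hb : b < 7) (hab : R a b) (hba : R b a) : Knows (setBits m a b) R := by
  intro c hc d hd hcd
  simp only [bitAt, _root_.setBits, Nat.testBit_or, Nat.testBit_two_pow, Bool.or_eq_true,
    decide_eq_true_eq] at hcd
  rcases hcd with (hcd | hcd) | hcd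
  · exact h c hc d hd hcd
  · obtain ⟨rfl, rfl⟩ : a = c ∧ b = d := by omega
    exact hab
  · obtain ⟨rfl, rfl⟩ : b = c ∧ a = d := by omega
    exact hba

/-- `f` enumerates `V` by the labels `0, …, 6`. -/
structure IsLabelling {V : Type*} (f : ℕ → V) : Prop where
  inj : ∀ a < 7, ∀ b < 7, f a = f b → a = b
  surj : ∀ v, ∃ a < 7, f a = v

lemma mem_others {a x y : ℕ} : a ∈ others x y ↔ a < 7 ∧ a ≠ x ∧ a ≠ y := by
  simp [others]

lemma IsLabelling.exists_mem_others {V : Type*} {f : ℕ → V} (hf : IsLabelling f) {x y : ℕ}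
    {v : V} (hx : v ≠ f x) (hy : v ≠ f y) : ∃ a ∈ others x y, f a = v := by
  obtain ⟨a, ha, rfl⟩ := hf.surj v
  exact ⟨a, mem_others.2 ⟨ha, fun h ↦ hx (h ▸ rfl), fun h ↦ hy (h ▸ rfl)⟩, rfl⟩

section Soundness

variable {V : Type*} {G : SimpleGraph V} {f : ℕ → V} {p n : ℕ}

lemma sureCommon_sound (hp : Knows p fun a b ↦ G.Adj (f a) (f b)) {l : List ℕ}
    (hl : ∀ c ∈ l, c < 7) {a b : ℕ} (ha : a < 7) (hb : b < 7) (h : sureCommon p l a b = true) :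
    ∃ c ∈ l, G.Adj (f a) (f c) ∧ G.Adj (f c) (f b) := by
  simp only [sureCommon, List.any_eq_true, Bool.and_eq_true] at h
  obtain ⟨c, hc, hac, hcb⟩ := h
  exact ⟨c, hc, hp a ha c (hl c hc) hac, hp c (hl c hc) b hb hcb⟩

lemma lt_of_mem_others {x y a : ℕ} (ha : a ∈ others x y) : a < 7 := (mem_others.1 ha).1

lemma IsLabelling.ne_of_mem_others (hf : IsLabelling f) {x y : ℕ} (hx : x < 7) (hy : y < 7)
    {a : ℕ} (ha : a ∈ others x y) : f a ≠ f x ∧ f a ≠ f y := by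
  obtain ⟨ha, hax, hay⟩ := mem_others.1 ha
  exact ⟨fun h ↦ hax (hf.inj a ha x hx h), fun h ↦ hay (hf.inj a ha y hy h)⟩

lemma sureBypass_sound (hf : IsLabelling f) (hp : Knows p fun a b ↦ G.Adj (f a) (f b))
    (hn : Knows n fun a b ↦ ¬ G.Adj (f a) (f b)) {x y z : ℕ} (hx : x < 7) (hy : y < 7)
    (hz : z < 7) (h : sureBypass p n (others x y) z = true) :
    Bypass G (f x) (f y) (f z) := by
  intro a b hax hay hbx hby hza hzb
  obtain ⟨a, ha, rfl⟩ := hf.exists_mem_others hax hay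
  obtain ⟨b, hb, rfl⟩ := hf.exists_mem_others hbx hby
  have ha' := lt_of_mem_others ha
  have hb' := lt_of_mem_others hb
  simp only [sureBypass, List.all_eq_true, Bool.or_eq_true, beq_iff_eq] at h
  rcases (h a ha).resolve_left (fun h ↦ hn z hz a ha' h hza) b hb with h | h | h | h
  · exact absurd hzb (hn z hz b hb' h)
  · exact .inl (h ▸ rfl)
  · exact .inr (.inl (hp a ha' b hb' h))
  · obtain ⟨c, hc, h⟩ := sureCommon_sound hp (fun _ ↦ lt_of_mem_others) ha' hb' h
    obtain ⟨hcx, hcy⟩ := hf.ne_of_mem_others hx hy hc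
    exact .inr (.inr ⟨f c, hcx, hcy, h⟩)

lemma sureEdgeBypass_sound (hf : IsLabelling f) (hp : Knows p fun a b ↦ G.Adj (f a) (f b))
    (hn : Knows n fun a b ↦ ¬ G.Adj (f a) (f b)) {x y : ℕ} (hx : x < 7) (hy : y < 7)
    (h : sureEdgeBypass p n (others x y) x y = true) : EdgeBypass G (f x) (f y) := by
  intro hxy a b hax hay hbx hby hxa hyb
  obtain ⟨a, ha, rfl⟩ := hf.exists_mem_others hax hay
  obtain ⟨b, hb, rfl⟩ := hf.exists_mem_others hbx hby
  have ha' := lt_of_mem_others ha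
  have hb' := lt_of_mem_others hb
  simp only [sureEdgeBypass, List.all_eq_true, List.any_eq_true, Bool.or_eq_true,
    Bool.and_eq_true, beq_iff_eq] at h
  rcases (h.resolve_left (fun h ↦ hn x hx y hy h hxy) a ha).resolve_left
    (fun h ↦ hn x hx a ha' h hxa) b hb with h | h | h | h | ⟨c, hc, hac, h⟩
  · exact absurd hyb (hn y hy b hb' h)
  · exact .inl (h ▸ rfl)
  · exact .inr (.inl (hp a ha' b hb' h))
  · obtain ⟨c, hc, h⟩ := sureCommon_sound hp (fun _ ↦ lt_of_mem_others) ha' hb' h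
    obtain ⟨hcx, hcy⟩ := hf.ne_of_mem_others hx hy hc
    exact .inr (.inr (.inl ⟨f c, hcx, hcy, h⟩))
  · have hc' := lt_of_mem_others hc
    obtain ⟨d, hd, h⟩ := sureCommon_sound hp (fun _ ↦ lt_of_mem_others) hc' hb' h
    obtain ⟨hcx, hcy⟩ := hf.ne_of_mem_others hx hy hc
    obtain ⟨hdx, hdy⟩ := hf.ne_of_mem_others hx hy hd
    exact .inr (.inr (.inr ⟨f c, hcx, hcy, hp a ha' c hc' hac, f d, hdx, hdy, h⟩))

lemma sureNotBypass_sound (hf : IsLabelling f) (hp : Knows p fun a b ↦ G.Adj (f a) (f b))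
    (hn : Knows n fun a b ↦ ¬ G.Adj (f a) (f b)) (h : sureNotBypass p n = true) :
    ¬ Bypass G (f 0) (f 0) (f 0) := by
  intro hb
  simp only [sureNotBypass, List.all_eq_true, List.any_eq_true, Bool.or_eq_true,
    Bool.and_eq_true, Bool.not_eq_true', beq_eq_false_iff_ne] at h
  obtain ⟨a, ha, h0a, b, hb', h0b, hab, hnab, h⟩ := h
  have ha7 := lt_of_mem_others ha
  have hb7 := lt_of_mem_others hb'
  have ha0 := (hf.ne_of_mem_others (by simp) (by simp) ha).1
  have hb0 := (hf.ne_of_mem_others (by simp) (by simp) hb').1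
  rcases hb (f a) (f b) ha0 ha0 hb0 hb0 (hp 0 (by simp) a ha7 h0a) (hp 0 (by simp) b hb7 h0b) with
    h' | h' | ⟨c, hc0, -, hac, hcb⟩
  · exact hab (hf.inj a ha7 b hb7 h')
  · exact hn a ha7 b hb7 hnab h'
  · obtain ⟨c, hc, rfl⟩ := hf.exists_mem_others hc0 hc0
    have hc7 := lt_of_mem_others hc
    rcases h c hc with h | h
    · exact hn a ha7 c hc7 h hac
    · exact hn c hc7 b hb7 h hcb

lemma CaseTree.check_sound (hf : IsLabelling f) (t : CaseTree)
    (hp : Knows p fun a b ↦ G.Adj (f a) (f b)) (hn : Knows n fun a b ↦ ¬ G.Adj (f a) (f b))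
    (h : t.check p n = true) :
    (∃ x y, x ≠ y ∧ Bypass G x y x ∧ Bypass G x y y ∧ EdgeBypass G x y) ∨
      ¬ Bypass G (f 0) (f 0) (f 0) ∨
        ∃ c, c ≠ f 0 ∧ c ≠ f 1 ∧ G.Adj (f 2) c ∧ G.Adj c (f 3) := by
  induction t generalizing p n with
  | split a b l r ihl ihr =>
    simp only [check, Bool.and_eq_true, decide_eq_true_eq] at h
    obtain ⟨⟨ha, hb⟩, hl, hr⟩ := h
    by_cases hab : G.Adj (f a) (f b)
    · exact ihr (hp.setBits ha hb hab hab.symm) hn hr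
    · exact ihl hp (hn.setBits ha hb hab fun h ↦ hab h.symm) hl
  | pair x y =>
    simp only [check, Bool.and_eq_true, decide_eq_true_eq] at h
    obtain ⟨⟨hxy, hy⟩, h₁, h₂, h₃⟩ := h
    have hx := hxy.trans hy
    exact .inl ⟨f x, f y, fun h ↦ hxy.ne (hf.inj x hx y hy h),
      sureBypass_sound hf hp hn hx hy hx h₁, sureBypass_sound hf hp hn hx hy hy h₂,
      sureEdgeBypass_sound hf hp hn hx hy h₃⟩
  | first => exact .inr (.inl (sureNotBypass_sound hf hp hn h))
  | common =>
    obtain ⟨c, hc, h⟩ := sureCommon_sound hp (by simp) (by simp) (by simp) h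
    have hc' : c ∈ others 0 1 := by
      simp only [List.mem_cons, List.not_mem_nil, or_false] at hc
      rw [mem_others]
      omega
    obtain ⟨h0, h1⟩ := hf.ne_of_mem_others (by simp) (by simp) hc'
    exact .inr (.inr ⟨f c, h0, h1, h⟩)

end Soundness

open CaseTree in
/-- The case distinction for labellings in which `2` and `3` are non-adjacent neighbours of `1`. -/
def caseTree : CaseTree :=
  split 0 3 (split 4 5 (split 1 6 (split 1 5 (split 2 5 (split 0 1 (split 2 6 (split 4 6
    (split 0 4 (split 0 6 (split 3 6 (pair 4 6) (pair 0 5)) (split 0 2 (pair 2 4) first))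
    (split 3 4 (split 0 6 (split 0 5 (pair 5 6) first) first) (pair 5 6))) (split 2 4 (split 0 2
    (split 1 4 (pair 1 2) (split 5 6 (pair 0 5) (pair 0 2))) (split 0 6 (split 0 4 (split 0 5
    (pair 0 2) first) (split 1 4 first (pair 3 5))) first)) (split 5 6 (split 0 6 (pair 0 5)
    (split 0 5 (pair 0 5) (split 3 6 first (pair 1 2)))) (pair 1 3)))) (split 0 4 (split 5 6
    (pair 0 5) (split 4 6 (pair 0 4) (pair 1 3))) (split 3 4 (split 5 6 (split 0 5 (pair 3 5)
    first) (pair 0 4)) (split 0 5 (split 4 6 (pair 0 4) (pair 0 5)) (split 4 6 (split 3 5 first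
    (split 0 2 (pair 2 6) (pair 5 6))) (pair 1 2)))))) (split 4 6 (pair 5 6) (split 1 4
    (split 0 6 (split 0 4 (split 5 6 (pair 0 5) (split 3 5 (split 0 5 (pair 0 5) first)
    (split 2 6 (pair 4 6) (pair 0 4)))) (split 3 6 (pair 3 5) (pair 2 5))) (split 3 4 (pair 3 5)
    (pair 2 5))) (pair 5 6)))) (split 2 6 (split 5 6 (split 2 4 (split 0 5 (split 0 6 (split 3 6
    (pair 5 6) (pair 0 4)) (split 0 2 (pair 2 5) first)) (split 3 5 (split 0 6 (split 0 4
    (pair 0 5) first) first) common)) (split 4 6 (pair 0 6) (split 3 6 (pair 0 6) (pair 0 5))))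
    (split 3 6 (split 4 6 (split 0 6 (pair 0 4) (split 0 4 (pair 3 4) first)) (split 1 4
    (split 0 1 (pair 1 3) (split 0 6 (pair 4 6) first)) (pair 0 3))) (pair 0 4))) (split 4 6
    (pair 0 4) (split 3 4 (pair 0 4) (pair 0 5))))) (split 3 4 (split 0 5 (split 2 4 (split 1 4
    (split 0 1 (split 0 6 (split 0 2 (pair 0 4) (pair 4 6)) (split 5 6 (pair 4 5) (pair 3 4)))
    (pair 4 6)) (pair 0 6)) (split 0 1 (split 4 6 (pair 0 6) (split 5 6 (pair 0 5) (pair 0 3)))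
    (pair 4 6))) (split 0 6 (split 5 6 (split 2 4 (pair 4 6) (pair 3 6)) (pair 2 4)) (split 1 4
    (split 2 6 (pair 2 4) (pair 3 4)) (pair 0 6)))) (split 0 4 (split 5 6 (split 2 6 (pair 0 6)
    (pair 0 5)) (split 4 6 (pair 3 4) (pair 0 2))) (split 0 5 (split 4 6 (split 0 2 (pair 0 6)
    (pair 5 6)) (split 5 6 (split 2 6 (pair 5 6) (pair 0 5)) (pair 0 2))) (pair 2 6)))))
    (split 0 5 (pair 0 4) (split 5 6 (split 3 5 (split 1 4 (split 2 5 (split 0 4 (pair 3 4)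
    first) (split 0 6 (pair 0 4) (pair 3 4))) (pair 0 5)) (split 0 6 (split 0 2 (pair 0 4)
    (pair 4 6)) (pair 2 4))) (split 0 2 (pair 0 4) (pair 3 4))))) (split 2 4 (split 5 6
    (split 4 6 (split 1 4 (split 0 6 (split 2 5 (split 0 4 (split 3 4 (pair 4 6) (pair 0 5))
    (split 0 2 (pair 2 6) first)) (split 0 1 (pair 0 6) (pair 4 5))) (split 0 5 (split 0 4
    (pair 4 5) (split 3 4 first (split 0 2 (pair 0 6) (pair 5 6)))) (split 1 5 (split 3 6
    (split 2 5 first (pair 3 4)) (pair 1 2)) (split 2 6 (pair 3 6) (pair 3 4))))) (split 0 5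
    (pair 0 6) (split 0 2 (pair 0 6) (pair 3 6)))) (split 0 1 (split 2 5 (split 1 4 (split 1 5
    (split 2 6 (split 1 6 (split 0 2 (pair 1 2) (split 0 6 (split 0 4 (split 0 5 (pair 0 2)
    first) first) first)) (pair 0 2)) (pair 1 3)) (split 2 6 (pair 0 2) (pair 0 3))) (pair 0 2))
    (split 1 6 (pair 1 3) (pair 0 3))) (split 0 6 (split 1 4 (split 1 5 (split 1 6 (split 2 5
    (split 0 4 (split 3 5 (split 0 5 (pair 0 5) first) (pair 4 6)) (split 3 4 first (pair 1 2)))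
    (split 3 4 (pair 3 6) (pair 0 6))) (pair 4 5)) (pair 4 6)) (pair 0 2)) (split 3 4 (pair 4 5)
    (pair 2 5))))) (split 0 1 (split 2 5 (split 2 6 (split 1 5 (split 0 2 (pair 0 2) (split 1 4
    (split 1 6 (split 0 6 (split 0 4 (split 0 5 (pair 0 2) first) first) first) (pair 0 2))
    (pair 0 2))) (pair 0 2)) (split 1 4 (pair 1 3) (pair 0 3))) (pair 1 3)) (split 0 6 (split 0 5
    (split 1 4 (split 1 5 (split 1 6 (split 3 4 (split 0 4 (pair 0 4) first) (split 2 5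
    (split 4 6 (pair 5 6) (split 0 4 (pair 0 5) (pair 1 2))) (pair 0 6))) (pair 4 5)) (pair 0 2))
    (pair 5 6)) (split 1 4 (split 3 6 (pair 3 4) (pair 2 4)) (pair 5 6))) (split 1 4 (split 3 5
    (pair 3 4) (pair 2 4)) (pair 2 3))))) (split 1 4 (split 3 5 (split 0 6 (split 1 6 (pair 3 6)
    (split 5 6 (pair 3 6) (pair 0 3))) (split 1 6 (split 4 6 (split 5 6 (split 2 5 (split 0 5
    (pair 0 6) first) (pair 0 6)) (split 0 1 (pair 1 3) (split 2 5 (pair 4 5) (pair 3 4))))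
    (split 0 1 (pair 1 3) (pair 3 5))) (split 5 6 (split 0 4 (pair 0 5) (pair 3 5)) (pair 0 3))))
    (pair 0 6)) (split 5 6 (pair 0 6) (split 3 6 (pair 0 6) (pair 0 2)))))) (split 0 6 (split 0 5
    (split 3 4 (split 3 5 (split 4 6 (split 1 4 (split 0 4 (split 2 4 (pair 0 4) (pair 5 6))
    first) (pair 5 6)) (split 1 4 (split 3 6 (split 0 4 (pair 0 3) first) (split 2 4 (split 1 5
    (pair 2 5) (split 5 6 (pair 4 5) (pair 0 4))) (pair 0 5))) (pair 0 3))) (split 2 4 (split 5 6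
    (pair 4 6) (split 2 6 (pair 4 6) (pair 0 4))) (split 4 5 (split 3 6 (pair 5 6) (pair 2 4))
    (pair 0 6)))) (split 4 6 (split 2 5 (pair 5 6) (split 4 5 (pair 0 4) (pair 0 6))) (split 2 6
    (split 1 5 (pair 2 5) (split 5 6 (pair 2 5) (pair 0 2))) (pair 0 5)))) (split 2 5 (split 1 4
    (split 0 1 (split 1 6 (split 0 4 (split 4 5 (split 1 5 (split 5 6 (pair 0 5) (split 3 5
    (split 3 6 first (pair 0 5)) (split 2 6 (pair 4 6) (pair 0 4)))) (pair 4 6)) (split 1 5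
    (split 5 6 (split 3 4 (split 3 5 first (split 2 4 (pair 4 6) (pair 0 6))) (pair 0 5))
    (pair 1 2)) (pair 4 6))) (split 2 4 (pair 2 6) (pair 5 6))) (split 1 5 (split 5 6 (split 0 4
    (pair 4 5) (split 4 6 (pair 5 6) (pair 2 5))) (pair 2 4)) (pair 0 4))) (split 5 6 (split 4 5
    (pair 4 6) (split 2 4 (pair 4 6) (pair 3 6))) (split 2 6 (split 3 4 (pair 2 4) (pair 5 6))
    (pair 3 4)))) (split 4 5 (pair 5 6) (pair 2 6))) (pair 4 6))) (split 0 5 (split 2 6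
    (split 0 4 (split 3 4 (split 3 6 (split 3 5 (split 1 6 first (pair 0 3)) (split 4 6
    (pair 2 4) (split 4 5 (pair 4 6) (pair 1 2)))) (split 5 6 (split 4 6 (pair 4 5) (split 2 4
    (pair 4 5) (pair 0 5))) (split 4 6 (split 2 5 (pair 4 5) (pair 0 4)) (pair 1 2)))) (split 5 6
    (pair 2 5) (split 4 5 (pair 5 6) (pair 1 2)))) (split 5 6 (split 4 5 (split 1 6 (pair 5 6)
    (pair 0 4)) (split 1 5 (pair 1 2) (pair 2 6))) (split 1 5 (split 2 4 (pair 2 5) (pair 5 6))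
    (pair 2 4)))) (pair 4 5)) (split 2 5 (split 4 6 (split 2 6 (split 1 4 (pair 2 4) (split 4 5
    (pair 2 4) (pair 2 6))) (pair 4 5)) (split 1 4 (pair 1 2) (pair 2 5))) (pair 4 6))))

lemma check_caseTree :
    caseTree.check (setBits (setBits 0 1 2) 1 3) (setBits 0 2 3) = true := by
  decide +kernel

lemma exists_isLabelling {V : Type*} [Fintype V] (hcard : Fintype.card V = 7) {x y u w : V}
    (hxy : x ≠ y) (hux : u ≠ x) (huy : u ≠ y) (hwx : w ≠ x) (hwy : w ≠ y) (huw : u ≠ w) :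
    ∃ f : ℕ → V, IsLabelling f ∧ f 0 = x ∧ f 1 = y ∧ f 2 = u ∧ f 3 = w := by
  classical
  have hS : ({x, y, u, w} : Finset V).card = 4 := by
    simp [*, Ne.symm hux, Ne.symm huy, Ne.symm hwx, Ne.symm hwy]
  have hT : ({x, y, u, w} : Finset V)ᶜ.card = 3 := by
    rw [Finset.card_compl, hcard, hS]
  obtain ⟨p, q, r, -, -, -, hpqr⟩ := Finset.card_eq_three.1 hT
  have hsurj : Function.Surjective ![x, y, u, w, p, q, r] := by
    intro v
    by_cases hv : v ∈ ({x, y, u, w} : Finset V)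
    · simp only [Finset.mem_insert, Finset.mem_singleton] at hv
      rcases hv with rfl | rfl | rfl | rfl
      exacts [⟨0, rfl⟩, ⟨1, rfl⟩, ⟨2, rfl⟩, ⟨3, rfl⟩]
    · rw [← Finset.mem_compl, hpqr] at hv
      simp only [Finset.mem_insert, Finset.mem_singleton] at hv
      rcases hv with rfl | rfl | rfl
      exacts [⟨4, rfl⟩, ⟨5, rfl⟩, ⟨6, rfl⟩]
  have hinj : Function.Injective ![x, y, u, w, p, q, r] :=
    ((Fintype.bijective_iff_surjective_and_card _).2 ⟨hsurj, by simp [hcard]⟩).1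
  refine ⟨fun k ↦ ![x, y, u, w, p, q, r] (Fin.ofNat 7 k), ⟨fun a ha b hb h ↦ ?_, fun v ↦ ?_⟩,
    rfl, rfl, rfl, rfl⟩
  · simpa [Fin.ext_iff, Nat.mod_eq_of_lt ha, Nat.mod_eq_of_lt hb] using hinj h
  · obtain ⟨i, hi⟩ := hsurj v
    exact ⟨i, i.2, by simpa using hi⟩

lemma exists_isDualMVSet_pair {V : Type*} [Fintype V] {G : SimpleGraph V}
    (hcard : Fintype.card V = 7) (hG : G.Connected) {x : V} (hx : IsDualMVSet G {x}) :
    ∃ y z, y ≠ z ∧ IsDualMVSet G {y, z} := by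
  have hB := bypass_of_isDualMVSet_singleton hx
  have : Nontrivial V := Fintype.one_lt_card_iff_nontrivial.1 (by omega)
  obtain ⟨y, hyx⟩ := exists_ne x
  by_cases hy : Bypass G x y y
  · obtain ⟨h₁, h₂⟩ := bypass_pair_of_bypass hyx.symm hB hy
    exact ⟨x, y, hyx.symm, isDualMVSet_pair hG h₁ hy h₂⟩
  · unfold Bypass at hy
    push Not at hy
    obtain ⟨u, w, hux, huy, hwx, hwy, hyu, hyw, huw, hnuw, hc⟩ := hy
    obtain ⟨f, hf, rfl, rfl, rfl, rfl⟩ := exists_isLabelling hcard hyx.symm hux huy hwx hwy huw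
    have h0 {R : ℕ → ℕ → Prop} : Knows 0 R := by simp [Knows, bitAt]
    rcases caseTree.check_sound hf
        ((h0.setBits (by simp) (by simp) hyu hyu.symm).setBits (by simp) (by simp) hyw hyw.symm)
        (h0.setBits (by simp) (by simp) hnuw fun h ↦ hnuw h.symm) check_caseTree with
      ⟨y, z, hyz, h₁, h₂, h₃⟩ | h | ⟨c, hc0, hc1, h, h'⟩
    · exact ⟨y, z, hyz, isDualMVSet_pair hG h₁ h₂ h₃⟩
    · exact absurd hB h
    · exact absurd h' (hc c hc0 hc1 h)

theorem stmt_17 {V : Type*} [Fintype V] (G : SimpleGraph V)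
    (hcard : Fintype.card V = 7) (hG : G.Connected) :
    muD G ≠ 1 := by
  intro h
  have hbdd : BddAbove {n | ∃ X : Set V, IsDualMVSet G X ∧ X.ncard = n} := by
    refine ⟨Nat.card V, ?_⟩
    rintro n ⟨X, -, rfl⟩
    exact Set.ncard_le_card X
  have hne : {n | ∃ X : Set V, IsDualMVSet G X ∧ X.ncard = n}.Nonempty := by
    refine Set.nonempty_iff_ne_empty.2 fun he ↦ ?_
    rw [muD, he, csSup_empty] at h
    exact absurd h (by simp)
  obtain ⟨X, hX, hX1⟩ := Nat.sSup_mem hne hbdd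
  obtain ⟨x, rfl⟩ := Set.ncard_eq_one.1 (hX1.trans h)
  obtain ⟨y, z, hyz, hpair⟩ := exists_isDualMVSet_pair hcard hG hX
  have h2 : 2 ≤ muD G := le_csSup hbdd ⟨{y, z}, hpair, Set.ncard_pair hyz⟩
  omega
end
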